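/- A coalition structure Γ of a FEN-hedonic game with distance-based preferences is perfect if and only if δ(⊵_i, Γ(i)) = 0 for every player i, equivalently if and only if N⁺_i ⊆ Γ(i) and N⁻_i ∩ Γ(i) = ∅ for every player i. -/

import Mathlib

/-! Basic machinery: weak orders, linear extensions, Kendall-tau,
and the directed Hausdorff–Kendall-tau distance. -/

section Orders

variable {P : Type*}

/-- The strict part `x ▷ y` of a relation `R`. -/
def strictOf (R : P → P → Prop) (x y : P) : Prop := R x y ∧ ¬ R y x

/-- The indifference part `x ∼ y` of a relation `R`. -/
def indiffOf (R : P → P → Prop) (x y : P) : Prop := R x y ∧ R y x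

/-- `R` is a weak order (total preorder) on the finite set `S`. -/
structure IsWeakOrderOn (S : Finset P) (R : P → P → Prop) : Prop where
  refl : ∀ x ∈ S, R x x
  trans : ∀ x ∈ S, ∀ y ∈ S, ∀ z ∈ S, R x y → R y z → R x z
  total : ∀ x ∈ S, ∀ y ∈ S, R x y ∨ R y x

/-- `A` is a linear extension on `S` of the weak order `R`: a strict total
order on `S` which is consistent with the strict part of `R`. -/
structure IsLinExtOn (S : Finset P) (R : P → P → Prop) (A : P → P → Prop) : Prop where
  irrefl : ∀ x ∈ S, ¬ A x x
  trans : ∀ x ∈ S, ∀ y ∈ S, ∀ z ∈ S, A x y → A y z → A x z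
  total : ∀ x ∈ S, ∀ y ∈ S, x ≠ y → A x y ∨ A y x
  extend : ∀ x ∈ S, ∀ y ∈ S, strictOf R x y → A x y

/-- The Kendall-tau distance between two strict (linear) orders on `S`:
the number of pairs ordered oppositely by the two orders. -/
noncomputable def kendallTau (S : Finset P) (A B : P → P → Prop) : ℕ :=
  Set.ncard {p : P × P | p.1 ∈ S ∧ p.2 ∈ S ∧ A p.1 p.2 ∧ B p.2 p.1}

/-- The directed Hausdorff–Kendall-tau distance `→τ(R1,R2)` between weak orders on `S`:
the maximum over linear extensions `B` of `R2` of the minimum over linear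
extensions `A` of `R1` of `τ(A,B)`. -/
noncomputable def dirTau (S : Finset P) (R1 R2 : P → P → Prop) : ℕ :=
  sSup { n : ℕ | ∃ B : P → P → Prop, IsLinExtOn S R2 B ∧
    n = sInf { m : ℕ | ∃ A : P → P → Prop, IsLinExtOn S R1 A ∧ m = kendallTau S A B } }

/-- The (undirected) Hausdorff–Kendall-tau distance `τ*`. -/
noncomputable def hkTau (S : Finset P) (R1 R2 : P → P → Prop) : ℕ :=
  max (dirTau S R1 R2) (dirTau S R2 R1)

end Orders

/-! FEN-hedonic games with distance-based preferences. -/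

section Game

/-- A FEN preference for player `i`: disjoint sets of friends and enemies
(not containing `i`) together with weak orders on the friends and on the enemies. -/
structure FENPref (P : Type*) (i : P) where
  friends : Finset P
  enemies : Finset P
  Rp : P → P → Prop
  Rm : P → P → Prop
  disj : Disjoint friends enemies
  self_not_friend : i ∉ friends
  self_not_enemy : i ∉ enemies
  wo_p : IsWeakOrderOn friends Rp
  wo_m : IsWeakOrderOn enemies Rm

variable {P : Type*} {i : P}

/-- The weak order `⊵⁺_i` on `N⁺_i ∪ {i}`: the friends, ordered by `⊵_i`,
all strictly above `i`. -/
def FENPref.prefPlus (pr : FENPref P i) (x y : P) : Prop :=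
  (x ∈ pr.friends ∧ y ∈ pr.friends ∧ pr.Rp x y) ∨
  (x ∈ pr.friends ∧ y = i) ∨
  (x = i ∧ y = i)

/-- The weak order `⊵⁻_i` on `N⁻_i ∪ {i}`: `i` strictly above all enemies,
which are ordered by `⊵_i`. -/
def FENPref.prefMinus (pr : FENPref P i) (x y : P) : Prop :=
  (x = i ∧ y = i) ∨
  (x = i ∧ y ∈ pr.enemies) ∨
  (x ∈ pr.enemies ∧ y ∈ pr.enemies ∧ pr.Rm x y)

/-- The weak order `C⁺_i` on `N⁺_i ∪ {i}`: friends in `C` strictly above `i`,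
ordered by `⊵_i`; friends not in `C` strictly below `i`, ordered by the reverse of `⊵_i`. -/
def FENPref.coalPlus (pr : FENPref P i) (C : Finset P) (x y : P) : Prop :=
  (x ∈ pr.friends ∧ x ∈ C ∧ y ∈ pr.friends ∧ y ∈ C ∧ pr.Rp x y) ∨
  ((x ∈ pr.friends ∧ x ∈ C) ∧ (y = i ∨ (y ∈ pr.friends ∧ y ∉ C))) ∨
  (x = i ∧ (y = i ∨ (y ∈ pr.friends ∧ y ∉ C))) ∨
  (x ∈ pr.friends ∧ x ∉ C ∧ y ∈ pr.friends ∧ y ∉ C ∧ pr.Rp y x)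

/-- The weak order `C⁻_i` on `N⁻_i ∪ {i}`: enemies in `C` strictly above `i`,
ordered by the reverse of `⊵_i`; enemies not in `C` strictly below `i`, ordered by `⊵_i`. -/
def FENPref.coalMinus (pr : FENPref P i) (C : Finset P) (x y : P) : Prop :=
  (x ∈ pr.enemies ∧ x ∈ C ∧ y ∈ pr.enemies ∧ y ∈ C ∧ pr.Rm y x) ∨
  ((x ∈ pr.enemies ∧ x ∈ C) ∧ (y = i ∨ (y ∈ pr.enemies ∧ y ∉ C))) ∨
  (x = i ∧ (y = i ∨ (y ∈ pr.enemies ∧ y ∉ C))) ∨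
  (x ∈ pr.enemies ∧ x ∉ C ∧ y ∈ pr.enemies ∧ y ∉ C ∧ pr.Rm x y)

variable [DecidableEq P]

/-- `δ⁺(⊵_i, C) = →τ(⊵⁺_i, C⁺_i)`. -/
noncomputable def FENPref.deltaPlus (pr : FENPref P i) (C : Finset P) : ℕ :=
  dirTau (insert i pr.friends) pr.prefPlus (pr.coalPlus C)

/-- `δ⁻(⊵_i, C) = →τ(⊵⁻_i, C⁻_i)`. -/
noncomputable def FENPref.deltaMinus (pr : FENPref P i) (C : Finset P) : ℕ :=
  dirTau (insert i pr.enemies) pr.prefMinus (pr.coalMinus C)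

/-- `δ(⊵_i, C) = δ⁺(⊵_i, C) + δ⁻(⊵_i, C)`. -/
noncomputable def FENPref.delta (pr : FENPref P i) (C : Finset P) : ℕ :=
  pr.deltaPlus C + pr.deltaMinus C

end Game

/-! Coalition structures and stability notions. -/

section Structures

variable {P : Type*} [DecidableEq P] [Fintype P]

/-- A coalition structure: a partition of the player set into nonempty coalitions. -/
def IsCoalitionStructure (Γ : Finset (Finset P)) : Prop :=
  ∅ ∉ Γ ∧ ∀ x : P, ∃! C, C ∈ Γ ∧ x ∈ C

/-- `Γ` is Nash stable: no player `k` and no coalition `C ∈ Γ ∪ {∅}` such that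
`k` strictly prefers `C ∪ {k}` to `k`'s own coalition. -/
def NashStable (pr : ∀ k : P, FENPref P k) (Γ : Finset (Finset P)) : Prop :=
  ¬ ∃ (k : P) (Ck C : Finset P), Ck ∈ Γ ∧ k ∈ Ck ∧ (C ∈ Γ ∨ C = ∅) ∧
      (pr k).delta (insert k C) < (pr k).delta Ck

/-- `Γ` is individually stable: no Nash deviation where the deviating player
is moreover welcome in the new coalition. -/
def IndividuallyStable (pr : ∀ k : P, FENPref P k) (Γ : Finset (Finset P)) : Prop :=
  ¬ ∃ (k : P) (Ck C : Finset P), Ck ∈ Γ ∧ k ∈ Ck ∧ (C ∈ Γ ∨ C = ∅) ∧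
      (pr k).delta (insert k C) < (pr k).delta Ck ∧
      ∀ j ∈ C, (pr j).delta (insert k C) ≤ (pr j).delta C

/-- `Γ` is contractually individually stable: no individual-stability deviation
where the deviating player is moreover not bound to the former coalition. -/
def ContractuallyIndividuallyStable (pr : ∀ k : P, FENPref P k) (Γ : Finset (Finset P)) : Prop :=
  ¬ ∃ (k : P) (Ck C : Finset P), Ck ∈ Γ ∧ k ∈ Ck ∧ (C ∈ Γ ∨ C = ∅) ∧
      (pr k).delta (insert k C) < (pr k).delta Ck ∧
      (∀ j ∈ C, (pr j).delta (insert k C) ≤ (pr j).delta C) ∧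
      (∀ j ∈ Ck.erase k, (pr j).delta (Ck.erase k) ≤ (pr j).delta Ck)

/-- `Γ` is perfect: every player is in one of their most preferred coalitions. -/
def PerfectStructure (pr : ∀ k : P, FENPref P k) (Γ : Finset (Finset P)) : Prop :=
  ∀ k : P, ∀ Ck ∈ Γ, k ∈ Ck → ∀ C : Finset P, k ∈ C → (pr k).delta Ck ≤ (pr k).delta C

end Structures

section Orders

variable {P : Type*} {S : Finset P} {R R₁ R₂ A B : P → P → Prop}

theorem kendallTau_self (hA : IsLinExtOn S R A) : kendallTau S A A = 0 := by
  rw [kendallTau, Set.ncard_eq_zero (Set.Finite.subset (S ×ˢ S).finite_toSet (by grind))]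
  ext ⟨x, y⟩
  simp only [Set.mem_ofPred_eq, Set.mem_empty_iff_false, iff_false]
  rintro ⟨hx, hy, hxy, hyx⟩
  exact hA.irrefl x hx (hA.trans x hx y hy x hx hxy hyx)

theorem kendallTau_le (S : Finset P) (A B : P → P → Prop) :
    kendallTau S A B ≤ (S ×ˢ S).card := by
  rw [kendallTau, ← Set.ncard_coe_finset]
  exact Set.ncard_le_ncard (by intro p; simp; tauto) (Finset.finite_toSet _)

theorem kendallTau_pos {x y : P} (hx : x ∈ S) (hy : y ∈ S) (hA : A x y) (hB : B y x) :
    0 < kendallTau S A B := by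
  rw [kendallTau, Set.ncard_pos (Set.Finite.subset (S ×ˢ S).finite_toSet
    (by intro p; simp; tauto))]
  exact ⟨(x, y), hx, hy, hA, hB⟩

/-- Every weak order has a linear extension: break ties by a well-order. -/
theorem IsWeakOrderOn.exists_isLinExtOn (h : IsWeakOrderOn S R) : ∃ A, IsLinExtOn S R A := by
  have htr : ∀ x y z : P, WellOrderingRel x y → WellOrderingRel y z → WellOrderingRel x z :=
    fun _ _ _ => _root_.trans
  have hirr : ∀ x : P, ¬ WellOrderingRel x x := fun x => irrefl_of WellOrderingRel x
  have htri : ∀ x y : P, x ≠ y → WellOrderingRel x y ∨ WellOrderingRel y x := fun x y hxy => by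
    rcases trichotomous_of WellOrderingRel x y with h | h | h <;> tauto
  refine ⟨fun x y => strictOf R x y ∨ (indiffOf R x y ∧ WellOrderingRel x y), ?_, ?_, ?_, ?_⟩
  · rintro x - (h | h)
    · exact h.2 h.1
    · exact hirr x h.2
  · intro x hx y hy z hz
    have h₁ := h.trans x hx y hy z hz
    have h₂ := h.trans z hz x hx y hy
    have h₃ := h.trans y hy z hz x hx
    have h₄ := h.trans z hz y hy x hx
    have h₅ := htr x y z
    simp only [strictOf, indiffOf]
    tauto
  · intro x hx y hy hxy
    have h₁ := h.total x hx y hy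
    have h₂ := htri x y hxy
    simp only [strictOf, indiffOf]
    tauto
  · exact fun x _ y _ hxy => Or.inl hxy

/-- The directed distance vanishes when the second order refines the first. -/
theorem dirTau_eq_zero (h : ∀ x ∈ S, ∀ y ∈ S, strictOf R₁ x y → strictOf R₂ x y) :
    dirTau S R₁ R₂ = 0 := by
  rw [dirTau, ← Nat.le_zero]
  refine csSup_le' ?_
  rintro n ⟨B, hB, rfl⟩
  have hB' : IsLinExtOn S R₁ B :=
    ⟨hB.irrefl, hB.trans, hB.total, fun x hx y hy hxy => hB.extend x hx y hy (h x hx y hy hxy)⟩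
  exact Nat.sInf_le ⟨B, hB', (kendallTau_self hB').symm⟩

/-- The directed distance is positive when the two orders strictly disagree on a pair. -/
theorem dirTau_pos (h₁ : IsWeakOrderOn S R₁) (h₂ : IsWeakOrderOn S R₂) {x y : P}
    (hx : x ∈ S) (hy : y ∈ S) (hxy : strictOf R₁ x y) (hyx : strictOf R₂ y x) :
    0 < dirTau S R₁ R₂ := by
  obtain ⟨A, hA⟩ := h₁.exists_isLinExtOn
  obtain ⟨B, hB⟩ := h₂.exists_isLinExtOn
  have hpos : 0 < sInf {m : ℕ | ∃ A, IsLinExtOn S R₁ A ∧ m = kendallTau S A B} := by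
    obtain ⟨A', hA', he⟩ := Nat.sInf_mem
      (s := {m : ℕ | ∃ A, IsLinExtOn S R₁ A ∧ m = kendallTau S A B}) ⟨_, A, hA, rfl⟩
    rw [he]
    exact kendallTau_pos hx hy (hA'.extend x hx y hy hxy) (hB.extend y hy x hx hyx)
  refine hpos.trans_le (le_csSup ⟨(S ×ˢ S).card, ?_⟩ ⟨B, hB, rfl⟩)
  rintro n ⟨B', -, rfl⟩
  refine le_trans (Nat.sInf_le ?_) (kendallTau_le S A B')
  exact ⟨A, hA, rfl⟩

end Orders

namespace FENPref

variable {P : Type*} [DecidableEq P] {i : P} (pr : FENPref P i) (C : Finset P)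

theorem isWeakOrderOn_prefPlus : IsWeakOrderOn (insert i pr.friends) pr.prefPlus := by
  have h₀ := pr.self_not_friend
  obtain ⟨h₁, h₂, h₃⟩ := pr.wo_p
  constructor <;> simp only [prefPlus] <;> grind

theorem isWeakOrderOn_coalPlus : IsWeakOrderOn (insert i pr.friends) (pr.coalPlus C) := by
  have h₀ := pr.self_not_friend
  obtain ⟨h₁, h₂, h₃⟩ := pr.wo_p
  constructor <;> simp only [coalPlus] <;> grind

theorem isWeakOrderOn_prefMinus : IsWeakOrderOn (insert i pr.enemies) pr.prefMinus := by
  have h₀ := pr.self_not_enemy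
  obtain ⟨h₁, h₂, h₃⟩ := pr.wo_m
  constructor <;> simp only [prefMinus] <;> grind

theorem isWeakOrderOn_coalMinus : IsWeakOrderOn (insert i pr.enemies) (pr.coalMinus C) := by
  have h₀ := pr.self_not_enemy
  obtain ⟨h₁, h₂, h₃⟩ := pr.wo_m
  constructor <;> simp only [coalMinus] <;> grind

theorem deltaPlus_eq_zero_iff : pr.deltaPlus C = 0 ↔ pr.friends ⊆ C := by
  have h₀ := pr.self_not_friend
  constructor
  · intro h f hf
    by_contra hfC
    refine (dirTau_pos pr.isWeakOrderOn_prefPlus (pr.isWeakOrderOn_coalPlus C)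
      (x := f) (y := i) (by simp [hf]) (by simp) ?_ ?_).ne' h
    · simp only [strictOf, prefPlus]; grind
    · simp only [strictOf, coalPlus]; grind
  · intro h
    refine dirTau_eq_zero fun x hx y hy => ?_
    simp only [strictOf, prefPlus, coalPlus]
    grind

theorem deltaMinus_eq_zero_iff : pr.deltaMinus C = 0 ↔ pr.enemies ∩ C = ∅ := by
  have h₀ := pr.self_not_enemy
  rw [← Finset.disjoint_iff_inter_eq_empty, Finset.disjoint_left]
  constructor
  · intro h f hf hfC
    refine (dirTau_pos pr.isWeakOrderOn_prefMinus (pr.isWeakOrderOn_coalMinus C)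
      (x := i) (y := f) (by simp) (by simp [hf]) ?_ ?_).ne' h
    · simp only [strictOf, prefMinus]; grind
    · simp only [strictOf, coalMinus]; grind
  · intro h
    refine dirTau_eq_zero fun x hx y hy => ?_
    simp only [strictOf, prefMinus, coalMinus]
    grind

theorem delta_eq_zero_iff : pr.delta C = 0 ↔ pr.friends ⊆ C ∧ pr.enemies ∩ C = ∅ := by
  rw [delta, Nat.add_eq_zero_iff, deltaPlus_eq_zero_iff, deltaMinus_eq_zero_iff]

/-- The coalition of `i` and all friends of `i` is at distance zero. -/
theorem delta_insert_friends : pr.delta (insert i pr.friends) = 0 := by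
  rw [delta_eq_zero_iff, ← Finset.disjoint_iff_inter_eq_empty, Finset.disjoint_insert_right]
  exact ⟨Finset.subset_insert _ _, pr.self_not_enemy, pr.disj.symm⟩

end FENPref

/-- A coalition structure `Γ` is perfect iff `δ(⊵_i, Γ(i)) = 0` for every player `i`,
equivalently iff `N⁺_i ⊆ Γ(i)` and `N⁻_i ∩ Γ(i) = ∅` for every player `i`. -/
theorem perfect_iff {P : Type*} [DecidableEq P] [Fintype P]
    (pr : ∀ k : P, FENPref P k) (Γ : Finset (Finset P)) (hΓ : IsCoalitionStructure Γ) :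
    (PerfectStructure pr Γ ↔ ∀ k : P, ∀ Ck ∈ Γ, k ∈ Ck → (pr k).delta Ck = 0) ∧
    (PerfectStructure pr Γ ↔ ∀ k : P, ∀ Ck ∈ Γ, k ∈ Ck →
        (pr k).friends ⊆ Ck ∧ (pr k).enemies ∩ Ck = ∅) := by
  have h : PerfectStructure pr Γ ↔ ∀ k : P, ∀ Ck ∈ Γ, k ∈ Ck → (pr k).delta Ck = 0 := by
    refine ⟨fun h k Ck hCk hk => Nat.le_zero.mp ?_, fun h k Ck hCk hk C _ => ?_⟩
    · rw [← (pr k).delta_insert_friends]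
      exact h k Ck hCk hk _ (Finset.mem_insert_self _ _)
    · rw [h k Ck hCk hk]
      exact Nat.zero_le _
  exact ⟨h, by simpa only [FENPref.delta_eq_zero_iff] using h⟩
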